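/- arXiv:0910.1308 — 2 statements merged into one kernel-verified Lean document; each statement's English description precedes it below -/
import Mathlib

section
/- Let p, n, i be natural numbers with 0 ≤ i ≤ min(p, n) and p + n − 2i ≠ 0, and let φ : R_p ⊗ R_n → R_{p+n−2i} be a nonzero sl₂-equivariant linear map. If it is not the case that both i = p and p < n, then the subspace span{ φ(u ⊗ x^n) : u ∈ R_p } of R_{p+n−2i} has dimension at least 2. If i = p and p < n, then this subspace is one-dimensional, spanned by φ(y^p ⊗ x^n), which is a nonzero highest weight vector, i.e., E·φ(y^p ⊗ x^n) = 0. -/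
noncomputable section

/-- `R m`: the space of homogeneous polynomials of degree `m` in two variables `x, y`;
the coordinate at `k` is the coefficient of the monomial `x^(m-k) * y^k`. -/
abbrev R (m : ℕ) : Type := Fin (m + 1) → ℂ

/-- The monomial `x^(m-k) * y^k` in `R m`. -/
def mon (m : ℕ) (k : Fin (m + 1)) : R m := Pi.single k 1

/-- The operator `E = x·∂/∂y` on `R m`:
`E (x^(m-k) y^k) = k · x^(m-k+1) y^(k-1)`, i.e. `(E a) k = (k+1) * a (k+1)`. -/
def Eop (m : ℕ) : R m →ₗ[ℂ] R m where
  toFun a := fun k =>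
    if h : (k : ℕ) + 1 < m + 1 then ((k : ℕ) + 1 : ℂ) * a ⟨(k : ℕ) + 1, h⟩ else 0
  map_add' a b := by
    funext k
    by_cases h : (k : ℕ) + 1 < m + 1
    · simp only [dif_pos h, Pi.add_apply]; ring
    · simp only [dif_neg h, Pi.add_apply]; ring
  map_smul' c a := by
    funext k
    by_cases h : (k : ℕ) + 1 < m + 1
    · simp only [dif_pos h, Pi.smul_apply, smul_eq_mul, RingHom.id_apply]; ring
    · simp only [dif_neg h, Pi.smul_apply, smul_eq_mul, RingHom.id_apply]; ring

/-- The operator `F = y·∂/∂x` on `R m`: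
`F (x^(m-k) y^k) = (m-k) · x^(m-k-1) y^(k+1)`, i.e. `(F a) k = (m-k+1) * a (k-1)`. -/
def Fop (m : ℕ) : R m →ₗ[ℂ] R m where
  toFun a := fun k =>
    if _h : 0 < (k : ℕ) then
      ((m : ℂ) - (k : ℕ) + 1) * a ⟨(k : ℕ) - 1, by have := k.isLt; omega⟩
    else 0
  map_add' a b := by
    funext k
    by_cases h : 0 < (k : ℕ)
    · simp only [dif_pos h, Pi.add_apply]; ring
    · simp only [dif_neg h, Pi.add_apply]; ring
  map_smul' c a := by
    funext k
    by_cases h : 0 < (k : ℕ)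
    · simp only [dif_pos h, Pi.smul_apply, smul_eq_mul, RingHom.id_apply]; ring
    · simp only [dif_neg h, Pi.smul_apply, smul_eq_mul, RingHom.id_apply]; ring

/-- The operator `H = x·∂/∂x − y·∂/∂y` on `R m`: `(H a) k = (m - 2k) * a k`. -/
def Hop (m : ℕ) : R m →ₗ[ℂ] R m where
  toFun a := fun k => ((m : ℂ) - 2 * (k : ℕ)) * a k
  map_add' a b := by
    funext k; simp only [Pi.add_apply]; ring
  map_smul' c a := by
    funext k
    simp only [Pi.smul_apply, smul_eq_mul, RingHom.id_apply]; ring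

/-- A bilinear map `φ : R p × R n → R l` (equivalently, a linear map `R p ⊗ R n → R l`)
is `sl₂`-equivariant if it intertwines the actions of `E`, `F` and `H`, where `sl₂` acts
on the tensor product `R p ⊗ R n` by the Leibniz rule. -/
def Equivariant {p n l : ℕ} (φ : R p →ₗ[ℂ] R n →ₗ[ℂ] R l) : Prop :=
  (∀ u w, φ (Eop p u) w + φ u (Eop n w) = Eop l (φ u w)) ∧
  (∀ u w, φ (Fop p u) w + φ u (Fop n w) = Fop l (φ u w)) ∧
  (∀ u w, φ (Hop p u) w + φ u (Hop n w) = Hop l (φ u w))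

end

theorem Hop_mon (m : ℕ) (k : Fin (m + 1)) :
    Hop m (mon m k) = ((m : ℂ) - 2 * (k : ℕ)) • mon m k := by
  funext j
  simp only [Hop, mon, LinearMap.coe_mk, AddHom.coe_mk, Pi.smul_apply, smul_eq_mul]
  by_cases h : j = k
  · subst h; rfl
  · simp [Pi.single_eq_of_ne h]

theorem Eop_mon_zero (m : ℕ) : Eop m (mon m ⟨0, Nat.succ_pos m⟩) = 0 := by
  funext j
  simp only [Eop, mon, LinearMap.coe_mk, AddHom.coe_mk, Pi.zero_apply]
  split_ifs with h
  · rw [Pi.single_eq_of_ne (fun e => Nat.succ_ne_zero _ (congrArg Fin.val e)), mul_zero]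
  · rfl

theorem Eop_mon_succ (m k : ℕ) (h : k + 1 < m + 1) :
    Eop m (mon m ⟨k + 1, h⟩) = ((k : ℂ) + 1) • mon m ⟨k, by omega⟩ := by
  funext j
  simp only [Eop, mon, LinearMap.coe_mk, AddHom.coe_mk, Pi.smul_apply, smul_eq_mul,
    Pi.single_apply, Fin.ext_iff]
  by_cases hj : (j : ℕ) = k
  · simp [hj]; omega
  · simp [hj]

theorem Fop_mon (m k : ℕ) (h : k + 1 < m + 1) :
    Fop m (mon m ⟨k, by omega⟩) = ((m : ℂ) - k) • mon m ⟨k + 1, h⟩ := by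
  funext j
  simp only [Fop, mon, LinearMap.coe_mk, AddHom.coe_mk, Pi.smul_apply, smul_eq_mul,
    Pi.single_apply, Fin.ext_iff]
  by_cases hj : (j : ℕ) = k + 1
  · simp [hj]; ring
  · by_cases h0 : 0 < (j : ℕ)
    · have : ¬ ((j : ℕ) - 1 = k) := by omega
      simp [hj, this]
    · simp [hj, h0]

theorem ext_mon {m : ℕ} {M : Type*} [AddCommMonoid M] [Module ℂ M] {f g : R m →ₗ[ℂ] M}
    (h : ∀ k, f (mon m k) = g (mon m k)) : f = g := by
  refine LinearMap.pi_ext' fun k => LinearMap.ext_ring ?_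
  simpa [mon] using h k

theorem Eop_apply_succ (m : ℕ) (a : R m) (j : ℕ) (h : j + 1 < m + 1) :
    Eop m a ⟨j, by omega⟩ = ((j : ℂ) + 1) * a ⟨j + 1, h⟩ := by
  simp only [Eop, LinearMap.coe_mk, AddHom.coe_mk, dif_pos h]

/-- If `φ(u, x^n) = 0` for all `u`, then `φ = 0`. -/
theorem phi_zero {p n l : ℕ} (φ : R p →ₗ[ℂ] R n →ₗ[ℂ] R l) (hequiv : Equivariant φ)
    (h0 : ∀ u, φ u (mon n ⟨0, Nat.succ_pos n⟩) = 0) : φ = 0 := by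
  have key : ∀ (k : ℕ) (hk : k < n + 1) (u : R p), φ u (mon n ⟨k, hk⟩) = 0 := by
    intro k
    induction k with
    | zero => intro _ u; exact h0 u
    | succ k ih =>
      intro hk u
      have h := hequiv.2.1 u (mon n ⟨k, by omega⟩)
      rw [ih, ih, Fop_mon n k hk, map_zero, zero_add, map_smul] at h
      refine (smul_eq_zero.1 h).resolve_left ?_
      refine sub_ne_zero.2 ?_
      exact_mod_cast (by omega : n ≠ k)
  refine LinearMap.ext fun u => ext_mon fun k => ?_
  simpa using key k k.2 u

theorem phi_weight {p n i : ℕ} (hip : i ≤ p) (hin : i ≤ n)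
    (φ : R p →ₗ[ℂ] R n →ₗ[ℂ] R (p + n - 2 * i)) (hequiv : Equivariant φ)
    (k : Fin (p + 1)) (j : Fin (p + n - 2 * i + 1)) (hj : (j : ℕ) + i ≠ k) :
    φ (mon p k) (mon n ⟨0, Nat.succ_pos n⟩) j = 0 := by
  have h := congrFun (hequiv.2.2 (mon p k) (mon n ⟨0, Nat.succ_pos n⟩)) j
  rw [Hop_mon, Hop_mon] at h
  simp only [map_smul, LinearMap.smul_apply, Pi.add_apply, Pi.smul_apply, smul_eq_mul, Hop,
    LinearMap.coe_mk, AddHom.coe_mk] at h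
  rw [Nat.cast_sub (by omega)] at h
  push_cast at h
  have h2 : ((j : ℕ) + i - (k : ℕ) : ℂ) * φ (mon p k) (mon n ⟨0, Nat.succ_pos n⟩) j = 0 := by
    linear_combination h / 2
  refine (mul_eq_zero.1 h2).resolve_left ?_
  refine sub_ne_zero.2 ?_
  exact_mod_cast hj

theorem phi_step {p n l : ℕ}
    (φ : R p →ₗ[ℂ] R n →ₗ[ℂ] R l) (hequiv : Equivariant φ)
    (k j : ℕ) (hk : k + 1 < p + 1) (hj : j + 1 < l + 1) :
    ((k : ℂ) + 1) * φ (mon p ⟨k, by omega⟩) (mon n ⟨0, Nat.succ_pos n⟩) ⟨j, by omega⟩ =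
    ((j : ℂ) + 1) * φ (mon p ⟨k + 1, hk⟩) (mon n ⟨0, Nat.succ_pos n⟩) ⟨j + 1, hj⟩ := by
  have h := congrFun (hequiv.1 (mon p ⟨k + 1, hk⟩) (mon n ⟨0, Nat.succ_pos n⟩)) ⟨j, by omega⟩
  rw [Eop_mon_zero, Eop_mon_succ, Eop_apply_succ _ _ _ hj] at h
  simpa using h

theorem phi_lead {p n i : ℕ} (hip : i ≤ p) (hin : i ≤ n)
    (φ : R p →ₗ[ℂ] R n →ₗ[ℂ] R (p + n - 2 * i)) (hequiv : Equivariant φ) (hφ : φ ≠ 0) :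
    φ (mon p ⟨i, by omega⟩) (mon n ⟨0, Nat.succ_pos n⟩) ⟨0, Nat.succ_pos _⟩ ≠ 0 := by
  intro h0
  apply hφ
  apply phi_zero φ hequiv
  have key : ∀ (t : ℕ) (h1 : i + t < p + 1) (h2 : t < p + n - 2 * i + 1),
      φ (mon p ⟨i + t, h1⟩) (mon n ⟨0, Nat.succ_pos n⟩) ⟨t, h2⟩ = 0 := by
    intro t
    induction t with
    | zero => intro _ _; exact h0
    | succ t ih =>
      intro h1 h2
      have h := phi_step φ hequiv (i + t) t h1 h2
      rw [ih, mul_zero] at h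
      exact (mul_eq_zero.1 h.symm).resolve_left (by exact_mod_cast Nat.succ_ne_zero t)
  have : φ.flip (mon n ⟨0, Nat.succ_pos n⟩) = 0 := by
    refine ext_mon fun k => ?_
    funext j
    simp only [LinearMap.flip_apply, LinearMap.zero_apply, Pi.zero_apply]
    by_cases hj : (j : ℕ) + i = k
    · obtain ⟨k, hk⟩ := k
      obtain ⟨j, hj'⟩ := j
      obtain rfl : k = i + j := by simp at hj; omega
      exact key j hk hj'
    · exact phi_weight hip hin φ hequiv k j hj
  intro u
  exact LinearMap.congr_fun this u

/-- Corollary 7.11 of the paper. Let `0 ≤ i ≤ min p n` with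
`p + n - 2i ≠ 0`, and let `φ : R_p ⊗ R_n → R_{p+n-2i}` be a nonzero `sl₂`-equivariant
linear map.  If not both `i = p` and `p < n`, then `span {φ(u ⊗ x^n) : u ∈ R_p}` has
dimension at least `2`; if `i = p` and `p < n`, then this span is one-dimensional, spanned
by `φ(y^p ⊗ x^n)`, a nonzero highest weight vector. -/
theorem stmt13 (p n i : ℕ) (hip : i ≤ p) (hin : i ≤ n) (hl : p + n - 2 * i ≠ 0)
    (φ : R p →ₗ[ℂ] R n →ₗ[ℂ] R (p + n - 2 * i))
    (hequiv : Equivariant φ) (hφ : φ ≠ 0) :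
    (¬(i = p ∧ p < n) →
      2 ≤ Module.finrank ℂ (LinearMap.range (φ.flip (mon n ⟨0, Nat.succ_pos n⟩)))) ∧
    ((i = p ∧ p < n) →
      LinearMap.range (φ.flip (mon n ⟨0, Nat.succ_pos n⟩)) =
        Submodule.span ℂ {φ (mon p (Fin.last p)) (mon n ⟨0, Nat.succ_pos n⟩)} ∧
      φ (mon p (Fin.last p)) (mon n ⟨0, Nat.succ_pos n⟩) ≠ 0 ∧
      Eop (p + n - 2 * i) (φ (mon p (Fin.last p)) (mon n ⟨0, Nat.succ_pos n⟩)) = 0) := by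
  have lead := phi_lead hip hin φ hequiv hφ
  refine ⟨fun hne => ?_, ?_⟩
  · have hlt : i + 1 < p + 1 := by omega
    have hl1 : 0 + 1 < p + n - 2 * i + 1 := by omega
    have hs := phi_step φ hequiv i 0 hlt hl1
    have lead1 : φ (mon p ⟨i + 1, hlt⟩) (mon n ⟨0, Nat.succ_pos n⟩) ⟨0 + 1, hl1⟩ ≠ 0 := by
      intro h
      rw [h, mul_zero] at hs
      exact lead ((mul_eq_zero.1 hs).resolve_left (by exact_mod_cast Nat.succ_ne_zero i))
    have w0 := phi_weight hip hin φ hequiv ⟨i, by omega⟩ ⟨0 + 1, hl1⟩ (by simp)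
    have w1 := phi_weight hip hin φ hequiv ⟨i + 1, hlt⟩ ⟨0, by omega⟩ (by simp)
    have hli : LinearIndependent ℂ
        ![φ.flip (mon n ⟨0, Nat.succ_pos n⟩) |>.rangeRestrict (mon p ⟨i, by omega⟩),
          φ.flip (mon n ⟨0, Nat.succ_pos n⟩) |>.rangeRestrict (mon p ⟨i + 1, hlt⟩)] := by
      rw [LinearIndependent.pair_iff]
      intro s t hst
      have hst' := congrArg Subtype.val hst
      have e0 := congrFun hst' ⟨0, by omega⟩
      have e1 := congrFun hst' ⟨0 + 1, hl1⟩
      simp only [Submodule.coe_add, Submodule.coe_smul, Pi.add_apply, Pi.smul_apply, smul_eq_mul, Submodule.coe_zero,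
        Pi.zero_apply] at e0 e1
      change s * φ _ _ _ + t * φ _ _ _ = 0 at e0 e1
      rw [w1, mul_zero, add_zero] at e0
      rw [w0, mul_zero, zero_add] at e1
      exact ⟨(mul_eq_zero.1 e0).resolve_right lead, (mul_eq_zero.1 e1).resolve_right lead1⟩
    simpa using hli.fintype_card_le_finrank
  · rintro ⟨rfl, hpn⟩
    refine ⟨le_antisymm ?_ ?_, fun h => lead (congrFun h _), ?_⟩
    · rw [LinearMap.range_le_iff_comap, eq_top_iff]
      intro u _
      have hu : u = ∑ k, u k • mon i k := by
        funext j
        simp [mon, Finset.sum_apply, Pi.single_apply]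
      rw [hu]
      refine Submodule.sum_mem _ fun k _ => Submodule.smul_mem _ _ ?_
      rw [Submodule.mem_comap, LinearMap.flip_apply]
      by_cases hk : k = Fin.last i
      · rw [hk]; exact Submodule.mem_span_singleton_self _
      · have : φ (mon i k) (mon n ⟨0, Nat.succ_pos n⟩) = 0 := by
          funext j
          refine phi_weight hip hin φ hequiv k j ?_
          have := k.2
          have : (k : ℕ) ≠ i := fun h => hk (Fin.ext h)
          omega
        rw [this]; exact Submodule.zero_mem _
    · rw [Submodule.span_singleton_le_iff_mem]
      exact ⟨_, rfl⟩
    · funext j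
      by_cases hj : (j : ℕ) + 1 < i + n - 2 * i + 1
      · have := Eop_apply_succ _ (φ (mon i (Fin.last i)) (mon n ⟨0, Nat.succ_pos n⟩)) j hj
        rw [phi_weight hip hin φ hequiv _ _ (by simp), mul_zero] at this
        exact this
      · simp only [Eop, LinearMap.coe_mk, AddHom.coe_mk, dif_neg hj, Pi.zero_apply]
end

section
/- Let p, l, j be natural numbers with j ≤ p and j ≤ l, and let τ : R_p ⊗ R_{l+p−2j} → R_l be an sl₂-equivariant linear map satisfying τ(y^p ⊗ x^{l+p−2j}) = x^{l−j} y^{j}. Then for every natural number k with 0 ≤ k ≤ l − j, τ(y^p ⊗ x^{l+p−2j−k} y^{k}) = (C(l−j, k) / C(l+p−2j, k)) · x^{l−j−k} y^{j+k}, where C(·,·) denotes the binomial coefficient. -/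
theorem Fop_mon_last (m : ℕ) : Fop m (mon m (Fin.last m)) = 0 := by
  funext i
  obtain ⟨i, hi⟩ := i
  simp only [Fop, mon, LinearMap.coe_mk, AddHom.coe_mk, Pi.single_apply, Fin.ext_iff,
    Fin.val_last, Pi.zero_apply]
  by_cases h1 : 0 < i
  · have : ¬ (i - 1 = m) := by omega
    simp [this]
  · simp [h1]

theorem choose_step (n k : ℕ) (h : k ≤ n) :
    (n.choose (k + 1) : ℂ) * (k + 1) = n.choose k * (n - k) := by
  have := Nat.choose_succ_right_eq n k
  rw [← Nat.cast_sub h]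
  exact_mod_cast this

theorem scalar_step (n l j k : ℕ) (hjl : j ≤ l) (hk : k + 1 ≤ l - j) (hn : k + 1 ≤ n) :
    ((n : ℂ) - k) ≠ 0 ∧
    ((l - j).choose k : ℂ) / (n.choose k : ℂ) * ((l : ℂ) - ((j + k : ℕ) : ℂ)) =
      ((n : ℂ) - k) * (((l - j).choose (k + 1) : ℂ) / (n.choose (k + 1) : ℂ)) := by
  have hnk : ((n : ℂ) - k) ≠ 0 := by
    rw [sub_ne_zero]
    have : n ≠ k := by omega
    exact_mod_cast this
  refine ⟨hnk, ?_⟩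
  have h1 := choose_step n k (by omega)
  have h2 := choose_step (l - j) k (by omega)
  rw [Nat.cast_sub hjl] at h2
  have hc : (n.choose k : ℂ) ≠ 0 := by
    exact_mod_cast (Nat.choose_pos (by omega : k ≤ n)).ne'
  have hc' : (n.choose (k + 1) : ℂ) ≠ 0 := by
    exact_mod_cast (Nat.choose_pos (by omega : k + 1 ≤ n)).ne'
  have hk1 : (k + 1 : ℂ) ≠ 0 := by exact_mod_cast Nat.succ_ne_zero k
  push_cast
  rw [← mul_div_assoc, div_mul_eq_mul_div, div_eq_div_iff hc hc']
  apply mul_right_cancel₀ hk1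
  linear_combination ((l - j).choose k * (l - (j + k)) : ℂ) * h1 - ((n - k) * n.choose k : ℂ) * h2

/-- normalization formula in the proof of Theorem 7.20. Let `j ≤ min p l`
and let `τ : R_p ⊗ R_{l+p-2j} → R_l` be an `sl₂`-equivariant linear map with
`τ(y^p ⊗ x^(l+p-2j)) = x^(l-j) y^j`.  Then for every `0 ≤ k ≤ l - j`,
`τ(y^p ⊗ x^(l+p-2j-k) y^k) = (C(l-j,k)/C(l+p-2j,k)) · x^(l-j-k) y^(j+k)`. -/
theorem stmt17 (p l j : ℕ) (hjp : j ≤ p) (hjl : j ≤ l)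
    (τ : R p →ₗ[ℂ] R (l + p - 2 * j) →ₗ[ℂ] R l)
    (hequiv : Equivariant τ)
    (hnorm : τ (mon p (Fin.last p)) (mon (l + p - 2 * j) ⟨0, Nat.succ_pos _⟩) =
      mon l ⟨j, by omega⟩) :
    ∀ k : ℕ, (hk : k ≤ l - j) →
      τ (mon p (Fin.last p)) (mon (l + p - 2 * j) ⟨k, by omega⟩) =
        (((l - j).choose k : ℂ) / ((l + p - 2 * j).choose k : ℂ)) •
          mon l ⟨j + k, by omega⟩ := by
  intro k
  induction k with
  | zero =>
    intro hk
    simpa using hnorm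
  | succ k ih =>
    intro hk
    have ih := ih (by omega)
    have hF := hequiv.2.1 (mon p (Fin.last p)) (mon (l + p - 2 * j) ⟨k, by omega⟩)
    rw [Fop_mon_last, ih, Fop_mon _ k (by omega), map_zero, LinearMap.zero_apply, zero_add,
      map_smul, map_smul, Fop_mon _ (j + k) (by omega)] at hF
    obtain ⟨hnk, hs⟩ := scalar_step (l + p - 2 * j) l j k hjl (by omega) (by omega)
    apply smul_right_injective _ hnk
    simp only
    rw [hF, smul_smul, smul_smul, hs]
    rfl
end
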